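/- For every L ≥ 0 there exists a finite constant C, depending only on L, with the following property. Let h_1, …, h_4 : ℝ → ℝ and L satisfy the deterministic form of Assumption 3.1, and let (X_1, …, X_4) be a centered jointly Gaussian random vector with E[X_j²] = 1 and ρ_{ij} = E[X_i X_j]. Then |E[h_1(X_1) h_2(X_2) h_3(X_3) h_4(X_4)]| ≤ C · max{ |ρ_{1j}| : 2 ≤ j ≤ 4 }. -/

import Mathlib

open MeasureTheory ProbabilityTheory Filter

/-- A measure on `ℝ × ℝ` is a centered jointly Gaussian pair if every linear
combination of the coordinates has a centered Gaussian law. -/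
def JointlyGaussianPair (μ : Measure (ℝ × ℝ)) : Prop :=
  ∀ a b : ℝ, ∃ v : NNReal,
    Measure.map (fun p => a * p.1 + b * p.2) μ = gaussianReal 0 v

/-- The deterministic form of Assumption 3.1. -/
def Assumption31 {ι : Type*} (h : ι → ℝ → ℝ) (L : ℝ) : Prop :=
  (∀ j, ContDiff ℝ 1 (h j)) ∧
  (∀ j, (h j 0) ^ 2 ≤ L) ∧
  (∀ j, (deriv (h j) 0) ^ 2 ≤ L) ∧
  (∀ j, ∃ Lj : ℝ, Lj ^ 2 ≤ L ∧
    ∀ x y : ℝ, |deriv (h j) x - deriv (h j) y| ≤ Lj * |x - y|) ∧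
  (∀ j, ∫ x, h j x ∂(gaussianReal 0 1) = 0) ∧
  (∀ i j, i ≠ j → ∀ μ : Measure (ℝ × ℝ), IsProbabilityMeasure μ →
    JointlyGaussianPair μ → (∫ p, p.1 ^ 2 ∂μ) = 1 → (∫ p, p.2 ^ 2 ∂μ) = 1 →
    |∫ p, h i p.1 * h j p.2 ∂μ| ≤ L * |∫ p, p.1 * p.2 ∂μ|)

/-- A finite family of random variables is centered jointly Gaussian if every
linear combination of them has a centered Gaussian law. -/
def JointlyGaussianVec {Ω : Type*} [MeasurableSpace Ω] (P : Measure Ω)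
    {m : ℕ} (X : Fin m → Ω → ℝ) : Prop :=
  ∀ v : Fin m → ℝ, ∃ σ : NNReal,
    Measure.map (fun ω => ∑ i, v i * X i ω) P = gaussianReal 0 σ

/-- A centered jointly Gaussian family is a Gaussian random vector. -/
theorem JointlyGaussianVec.hasGaussianLaw {Ω : Type*} [MeasurableSpace Ω] {P : Measure Ω}
    {m : ℕ} {X : Fin m → Ω → ℝ} (hm : ∀ i, Measurable (X i)) (hX : JointlyGaussianVec P X) :
    HasGaussianLaw (fun ω i => X i ω) P where
  isGaussian_map := by
    refine isGaussian_of_isGaussian_map fun T => ?_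
    obtain ⟨σ, hσ⟩ := hX fun i => T (Pi.single i 1)
    rw [Measure.map_map (by fun_prop) (measurable_pi_lambda _ hm)]
    have hT : (T ∘ fun ω i => X i ω) = fun ω => ∑ i, T (Pi.single i 1) * X i ω := by
      ext ω
      have h := T.toLinearMap.pi_apply_eq_sum_univ fun i => X i ω
      simpa [mul_comm, ← Pi.single_apply, Pi.single_comm] using! h
    rw [hT, hσ]
    infer_instance

/-- Each coordinate of a centered jointly Gaussian family is a centered Gaussian. -/
theorem JointlyGaussianVec.exists_map_eq {Ω : Type*} [MeasurableSpace Ω] {P : Measure Ω}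
    {m : ℕ} {X : Fin m → Ω → ℝ} (hX : JointlyGaussianVec P X) (i : Fin m) :
    ∃ σ : NNReal, P.map (X i) = gaussianReal 0 σ := by
  obtain ⟨σ, hσ⟩ := hX (Pi.single i 1)
  refine ⟨σ, ?_⟩
  simpa [Pi.single_apply] using hσ

theorem integral_eq_zero_of_map_eq_gaussianReal {Ω : Type*} [MeasurableSpace Ω] {P : Measure Ω}
    {X : Ω → ℝ} (hm : Measurable X) {σ : NNReal} (hX : P.map X = gaussianReal 0 σ) :
    ∫ ω, X ω ∂P = 0 := by
  have h := integral_map (μ := P) hm.aemeasurable (f := fun x : ℝ => x) (by fun_prop)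
  rw [← h, hX, integral_id_gaussianReal]

theorem map_eq_gaussianReal_zero_one {Ω : Type*} [MeasurableSpace Ω] {P : Measure Ω}
    {X : Ω → ℝ} (hm : Measurable X) {σ : NNReal} (hX : P.map X = gaussianReal 0 σ)
    (h1 : ∫ ω, X ω * X ω ∂P = 1) : P.map X = gaussianReal 0 1 := by
  have hv : Var[X; P] = σ := by
    rw [← variance_id_map hm.aemeasurable, hX, variance_id_gaussianReal]
  rw [variance_of_integral_eq_zero hm.aemeasurable
    (integral_eq_zero_of_map_eq_gaussianReal hm hX)] at hv
  have hσ : (σ : ℝ) = 1 := by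
    rw [← hv, ← h1]
    simp [sq]
  rw [hX, NNReal.coe_eq_one.mp hσ]

/-- A coordinate of unit variance is independent of the residuals of its regression. -/
theorem JointlyGaussianVec.indepFun_residual {Ω : Type*} [MeasurableSpace Ω] {P : Measure Ω}
    {m : ℕ} {X : Fin m → Ω → ℝ} (hm : ∀ i, Measurable (X i)) (hX : JointlyGaussianVec P X)
    (k : Fin m) (hk : ∫ ω, X k ω * X k ω ∂P = 1) :
    IndepFun (X k) (fun ω j => X j ω - (∫ ω', X k ω' * X j ω' ∂P) * X k ω) P := by
  have hG := hX.hasGaussianLaw hm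
  have := hG.isProbabilityMeasure
  have hL (j : Fin m) : MemLp (X j) 2 P := (hG.eval j).memLp_two
  have h0 (j : Fin m) : ∫ ω, X j ω ∂P = 0 :=
    integral_eq_zero_of_map_eq_gaussianReal (hm j) (hX.exists_map_eq j).choose_spec
  have hcov (i j : Fin m) : cov[X i, X j; P] = ∫ ω, X i ω * X j ω ∂P := by
    rw [covariance_eq_sub (hL i) (hL j), h0 i, zero_mul, sub_zero]
    rfl
  let T : (Fin m → ℝ) →L[ℝ] (Unit → ℝ) × (Fin m → ℝ) :=
    (ContinuousLinearMap.pi fun _ => ContinuousLinearMap.proj k).prod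
      (ContinuousLinearMap.pi fun j => ContinuousLinearMap.proj j -
        (∫ ω', X k ω' * X j ω' ∂P) • ContinuousLinearMap.proj k)
  have hind := HasGaussianLaw.indepFun_of_covariance_eval (P := P)
    (X := fun _ : Unit => X k)
    (Y := fun j ω => X j ω - (∫ ω', X k ω' * X j ω' ∂P) * X k ω)
    (by simpa [T] using! hG.map_fun T) (fun _ j => by
      rw [covariance_fun_sub_right (hL k) (hL j) ((hL k).const_mul _),
        covariance_const_mul_right, hcov, hcov, hk, mul_one, sub_self])
  exact hind.comp (φ := fun u : Unit → ℝ => u ()) (ψ := id) (by fun_prop) measurable_id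

theorem abs_integral_mul_le_one {Ω : Type*} [MeasurableSpace Ω] {P : Measure Ω}
    {X Y : Ω → ℝ} (hX : MemLp X 2 P) (hY : MemLp Y 2 P)
    (hXX : ∫ ω, X ω * X ω ∂P = 1) (hYY : ∫ ω, Y ω * Y ω ∂P = 1) :
    |∫ ω, X ω * Y ω ∂P| ≤ 1 := by
  have iXX : Integrable (fun ω => X ω * X ω) P := hX.integrable_mul hX
  have iYY : Integrable (fun ω => Y ω * Y ω) P := hY.integrable_mul hY
  have hi : Integrable (fun ω => (X ω * X ω + Y ω * Y ω) / 2) P := (iXX.add iYY).div_const 2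
  calc |∫ ω, X ω * Y ω ∂P| ≤ ∫ ω, (X ω * X ω + Y ω * Y ω) / 2 ∂P := by
        refine norm_integral_le_of_norm_le (f := fun ω => X ω * Y ω) hi (.of_forall fun ω => ?_)
        rw [Real.norm_eq_abs, abs_le]
        constructor <;> nlinarith [sq_nonneg (X ω + Y ω), sq_nonneg (X ω - Y ω)]
    _ = 1 := by
        rw [integral_div, integral_add iXX iYY, hXX, hYY]
        norm_num

theorem abs_sub_le_of_deriv_growth {f : ℝ → ℝ} {A : ℝ} (hf : Differentiable ℝ f)
    (hd : ∀ x, |deriv f x| ≤ A * (1 + |x|)) (hA : 0 ≤ A) {x y R : ℝ} (hx : |x| ≤ R)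
    (hy : |y| ≤ R) : |f x - f y| ≤ A * (1 + R) * |x - y| := by
  refine (convex_Icc (-R) R).norm_image_sub_le_of_norm_deriv_le (fun z _ => hf z)
    (fun z hz => ?_) (abs_le.mp hy) (abs_le.mp hx)
  refine (hd z).trans ?_
  gcongr
  exact abs_le.mpr hz

theorem Assumption31.abs_deriv_le {ι : Type*} {h : ι → ℝ → ℝ} {L : ℝ} (H : Assumption31 h L)
    (j : ι) (x : ℝ) : |deriv (h j) x| ≤ √L * (1 + |x|) := by
  obtain ⟨-, -, hd, hlip, -, -⟩ := H
  obtain ⟨K, hK, hlip⟩ := hlip j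
  have h1 : |deriv (h j) 0| ≤ √L := Real.abs_le_sqrt (hd j)
  have h2 : |deriv (h j) x - deriv (h j) 0| ≤ √L * |x| := by
    refine (hlip x 0).trans ?_
    rw [sub_zero]
    gcongr
    exact (le_abs_self K).trans (Real.abs_le_sqrt hK)
  calc |deriv (h j) x| = |(deriv (h j) x - deriv (h j) 0) + deriv (h j) 0| := by ring_nf
    _ ≤ √L * |x| + √L := (abs_add_le _ _).trans (add_le_add h2 h1)
    _ = √L * (1 + |x|) := by ring

theorem Assumption31.abs_sub_le {ι : Type*} {h : ι → ℝ → ℝ} {L : ℝ} (H : Assumption31 h L)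
    (j : ι) {x y R : ℝ} (hx : |x| ≤ R) (hy : |y| ≤ R) :
    |h j x - h j y| ≤ √L * (1 + R) * |x - y| :=
  abs_sub_le_of_deriv_growth ((H.1 j).differentiable (by norm_num)) (H.abs_deriv_le j)
    (Real.sqrt_nonneg L) hx hy

theorem Assumption31.abs_le {ι : Type*} {h : ι → ℝ → ℝ} {L : ℝ} (H : Assumption31 h L)
    (j : ι) {x R : ℝ} (hx : |x| ≤ R) : |h j x| ≤ √L * (1 + R) ^ 2 := by
  have hR : 0 ≤ R := (abs_nonneg x).trans hx
  have h1 : |h j 0| ≤ √L := Real.abs_le_sqrt (H.2.1 j)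
  have h2 := H.abs_sub_le j hx (y := 0) (by simpa using hR)
  rw [sub_zero] at h2
  calc |h j x| = |(h j x - h j 0) + h j 0| := by ring_nf
    _ ≤ √L * (1 + R) * R + √L :=
      (abs_add_le _ _).trans (add_le_add (h2.trans (by gcongr)) h1)
    _ ≤ √L * (1 + R) ^ 2 := by nlinarith [Real.sqrt_nonneg L, mul_nonneg (Real.sqrt_nonneg L) hR]

theorem abs_mul_sub_mul_le {a a' b b' B C D E : ℝ} (ha : |a| ≤ B) (hb' : |b'| ≤ C)
    (hab : |a - a'| ≤ D) (hbb : |b - b'| ≤ E) : |a * b - a' * b'| ≤ B * E + D * C := by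
  calc |a * b - a' * b'| = |a * (b - b') + (a - a') * b'| := by ring_nf
    _ ≤ |a| * |b - b'| + |a - a'| * |b'| := by
      simpa only [abs_mul] using abs_add_le (a * (b - b')) ((a - a') * b')
    _ ≤ B * E + D * C := by
      have := (abs_nonneg _).trans ha
      have := (abs_nonneg _).trans hab
      gcongr

theorem abs_mul_four_sub_le {a a₁ a₂ a₃ b₁ b₂ b₃ B r : ℝ} (ha : |a| ≤ B) (ha₁ : |a₁| ≤ B)
    (ha₂ : |a₂| ≤ B) (hb₂ : |b₂| ≤ B) (hb₃ : |b₃| ≤ B)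
    (h₁ : |a₁ - b₁| ≤ r * B) (h₂ : |a₂ - b₂| ≤ r * B) (h₃ : |a₃ - b₃| ≤ r * B) :
    |a * a₁ * a₂ * a₃ - a * (b₁ * b₂ * b₃)| ≤ 3 * r * B ^ 4 := by
  have hB : 0 ≤ B := (abs_nonneg a).trans ha
  have hbb : |b₂ * b₃| ≤ B * B := by
    rw [abs_mul]
    gcongr
  calc |a * a₁ * a₂ * a₃ - a * (b₁ * b₂ * b₃)|
      = |a| * |a₁ * (a₂ * a₃) - b₁ * (b₂ * b₃)| := by rw [← abs_mul]; ring_nf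
    _ ≤ B * (B * (B * (r * B) + r * B * B) + r * B * (B * B)) := by
      gcongr
      exact abs_mul_sub_mul_le ha₁ hbb h₁ (abs_mul_sub_mul_le ha₂ hb₃ h₂ h₃)
    _ = 3 * r * B ^ 4 := by ring

theorem integrable_one_add_abs_pow_gaussianReal (n : ℕ) (v : NNReal) :
    Integrable (fun x : ℝ => (1 + |x|) ^ n) (gaussianReal 0 v) := by
  have h : MemLp (fun x : ℝ => 1 + |x|) n (gaussianReal 0 v) :=
    (memLp_const (1 : ℝ)).add (memLp_id_gaussianReal' n (by simp)).abs
  refine h.integrable_norm_pow'.congr (.of_forall fun x => ?_)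
  simp only [Real.norm_eq_abs]
  rw [abs_of_nonneg (by positivity)]

/-- The sum of `1 + |X i|` over four standard Gaussians has an eighth moment bounded by an
absolute constant. -/
theorem integrable_sum_pow_and_integral_le {Ω : Type*} [MeasurableSpace Ω] {P : Measure Ω}
    {X : Fin 4 → Ω → ℝ} (hm : ∀ i, Measurable (X i))
    (hX : ∀ i, P.map (X i) = gaussianReal 0 1) :
    Integrable (fun ω => (∑ i, (1 + |X i ω|)) ^ 8) P ∧
      ∫ ω, (∑ i, (1 + |X i ω|)) ^ 8 ∂P ≤
        4 ^ 8 * ∫ x, (1 + |x|) ^ 8 ∂(gaussianReal 0 1) := by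
  have hint (i : Fin 4) : Integrable (fun ω => (1 + |X i ω|) ^ 8) P := by
    have h := integrable_one_add_abs_pow_gaussianReal 8 1
    rw [← hX i] at h
    exact h.comp_measurable (hm i)
  have heq (i : Fin 4) :
      ∫ ω, (1 + |X i ω|) ^ 8 ∂P = ∫ x, (1 + |x|) ^ 8 ∂(gaussianReal 0 1) := by
    rw [← hX i, integral_map (hm i).aemeasurable (by fun_prop)]
  have hle (ω : Ω) : (∑ i, (1 + |X i ω|)) ^ 8 ≤ 4 ^ 7 * ∑ i, (1 + |X i ω|) ^ 8 := by
    simpa using! pow_sum_le_card_mul_sum_pow (s := Finset.univ)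
      (f := fun i => 1 + |X i ω|) (fun i _ => by positivity) 7
  have hsum : Integrable (fun ω => 4 ^ 7 * ∑ i, (1 + |X i ω|) ^ 8) P :=
    (integrable_finsetSum _ fun i _ => hint i).const_mul _
  have hS : Integrable (fun ω => (∑ i, (1 + |X i ω|)) ^ 8) P := by
    refine hsum.mono' (by fun_prop) (.of_forall fun ω => ?_)
    rw [Real.norm_eq_abs, abs_of_nonneg (by positivity)]
    exact hle ω
  refine ⟨hS, (integral_mono hS hsum hle).trans_eq ?_⟩
  rw [integral_const_mul, integral_finsetSum _ fun i _ => hint i]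
  simp only [heq, Finset.sum_const, Finset.card_univ, Fintype.card_fin, nsmul_eq_mul]
  ring

/-- Lemma 3.3, inequality (3.7): for every `L ≥ 0` there is a constant `C`,
depending only on `L`, such that `|E[∏ h_j(X_j)]| ≤ C max_{2 ≤ j ≤ 4} |ρ_{1j}|`. -/
theorem product_bound_first_row (L : ℝ) (hL : 0 ≤ L) :
    ∃ C : ℝ, ∀ (h : Fin 4 → ℝ → ℝ), Assumption31 h L →
      ∀ (Ω : Type) [MeasurableSpace Ω] (P : Measure Ω), IsProbabilityMeasure P →
      ∀ X : Fin 4 → Ω → ℝ, (∀ i, Measurable (X i)) →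
      JointlyGaussianVec P X →
      ∀ ρ : Fin 4 → Fin 4 → ℝ,
      (∀ i j, ρ i j = ∫ ω, X i ω * X j ω ∂P) →
      (∀ i, ρ i i = 1) →
      |∫ ω, h 0 (X 0 ω) * h 1 (X 1 ω) * h 2 (X 2 ω) * h 3 (X 3 ω) ∂P| ≤
        C * max (max |ρ 0 1| |ρ 0 2|) |ρ 0 3| := by
  set m := ∫ x, (1 + |x|) ^ 8 ∂(gaussianReal 0 1)
  refine ⟨3 * √L ^ 4 * (4 ^ 8 * m), fun h H Ω _ P _ X hm hX ρ hρ hρ1 => ?_⟩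
  set r := max (max |ρ 0 1| |ρ 0 2|) |ρ 0 3|
  have hG := hX.hasGaussianLaw hm
  have hvar (i : Fin 4) : ∫ ω, X i ω * X i ω ∂P = 1 := by rw [← hρ, hρ1]
  have hlaw (i : Fin 4) : P.map (X i) = gaussianReal 0 1 :=
    map_eq_gaussianReal_zero_one (hm i) (hX.exists_map_eq i).choose_spec (hvar i)
  have hρle (j : Fin 4) : |ρ 0 j| ≤ 1 := by
    rw [hρ]
    exact abs_integral_mul_le_one (hG.eval 0).memLp_two (hG.eval j).memLp_two (hvar 0) (hvar j)
  have hcont (i : Fin 4) : Continuous (h i) := (H.1 i).continuous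
  have hmeas (i : Fin 4) : Measurable (h i) := (hcont i).measurable
  have hind : IndepFun (X 0) (fun ω j => X j ω - ρ 0 j * X 0 ω) P := by
    simpa only [hρ] using hX.indepFun_residual hm 0 (hvar 0)
  have hzero : ∫ ω, h 0 (X 0 ω) * (h 1 (X 1 ω - ρ 0 1 * X 0 ω) *
      h 2 (X 2 ω - ρ 0 2 * X 0 ω) * h 3 (X 3 ω - ρ 0 3 * X 0 ω)) ∂P = 0 := by
    have hi := hind.comp (φ := h 0) (ψ := fun y : Fin 4 → ℝ => h 1 (y 1) * h 2 (y 2) * h 3 (y 3))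
      (hmeas 0) (by fun_prop)
    have hmul := hi.integral_fun_mul_eq_mul_integral
      (by fun_prop) (by fun_prop)
    simp only [Function.comp_apply] at hmul
    have h0 : ∫ ω, h 0 (X 0 ω) ∂P = 0 := by
      rw [← H.2.2.2.2.1 0, ← hlaw 0, integral_map (hm 0).aemeasurable (by fun_prop)]
    rw [hmul, h0, zero_mul]
  obtain ⟨hS, hSle⟩ := integrable_sum_pow_and_integral_le hm hlaw
  set S : Ω → ℝ := fun ω => ∑ i, (1 + |X i ω|) with hSdef
  have hSx (ω : Ω) : S ω = 4 + |X 0 ω| + |X 1 ω| + |X 2 ω| + |X 3 ω| := by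
    simp only [hSdef, Fin.sum_univ_four]
    ring
  have hXS (i : Fin 4) (ω : Ω) : |X i ω| ≤ S ω - 1 := by
    rw [hSx]
    fin_cases i <;> simp <;>
      linarith [abs_nonneg (X 0 ω), abs_nonneg (X 1 ω), abs_nonneg (X 2 ω), abs_nonneg (X 3 ω)]
  have hYS (i : Fin 4) (hi : i ≠ 0) (ω : Ω) : |X i ω - ρ 0 i * X 0 ω| ≤ S ω - 1 := by
    have h1 : |X i ω - ρ 0 i * X 0 ω| ≤ |X i ω| + |X 0 ω| := by
      refine (abs_sub _ _).trans ?_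
      rw [abs_mul]
      gcongr
      exact mul_le_of_le_one_left (abs_nonneg _) (hρle i)
    refine h1.trans ?_
    rw [hSx]
    fin_cases i <;> simp at hi ⊢ <;>
      linarith [abs_nonneg (X 0 ω), abs_nonneg (X 1 ω), abs_nonneg (X 2 ω), abs_nonneg (X 3 ω)]
  have hr (i : Fin 4) (hi : i ≠ 0) : |ρ 0 i| ≤ r := by
    fin_cases i <;> simp [r] at hi ⊢
  have hbX (i : Fin 4) (ω : Ω) : |h i (X i ω)| ≤ √L * S ω ^ 2 := by
    simpa using H.abs_le i (hXS i ω)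
  have hbY (i : Fin 4) (hi : i ≠ 0) (ω : Ω) :
      |h i (X i ω - ρ 0 i * X 0 ω)| ≤ √L * S ω ^ 2 := by
    simpa using H.abs_le i (hYS i hi ω)
  have hdiff (i : Fin 4) (hi : i ≠ 0) (ω : Ω) :
      |h i (X i ω) - h i (X i ω - ρ 0 i * X 0 ω)| ≤ r * (√L * S ω ^ 2) := by
    have hS0 : 0 ≤ S ω := by linarith [abs_nonneg (X 0 ω), hXS 0 ω]
    have h1 := H.abs_sub_le i (hXS i ω) (hYS i hi ω)
    rw [sub_sub_cancel, abs_mul, add_sub_cancel] at h1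
    calc _ ≤ √L * S ω * (|ρ 0 i| * |X 0 ω|) := h1
      _ ≤ √L * S ω * (r * S ω) := by
        gcongr
        · exact hr i hi
        · linarith [hXS 0 ω]
      _ = r * (√L * S ω ^ 2) := by ring
  have hprod {a b c d B : ℝ} (ha : |a| ≤ B) (hb : |b| ≤ B) (hc : |c| ≤ B) (hd : |d| ≤ B) :
      |a * b * c * d| ≤ B ^ 4 := by
    have hB : 0 ≤ B := (abs_nonneg a).trans ha
    calc |a * b * c * d| = |a| * |b| * |c| * |d| := by simp only [abs_mul]
      _ ≤ B * B * B * B := by gcongr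
      _ = B ^ 4 := by ring
  have hB : Integrable (fun ω => (√L * S ω ^ 2) ^ 4) P :=
    (hS.const_mul (√L ^ 4)).congr (.of_forall fun ω => by ring)
  have hintX : Integrable
      (fun ω => h 0 (X 0 ω) * h 1 (X 1 ω) * h 2 (X 2 ω) * h 3 (X 3 ω)) P :=
    hB.mono' (by fun_prop) (.of_forall fun ω =>
      hprod (hbX 0 ω) (hbX 1 ω) (hbX 2 ω) (hbX 3 ω))
  have hintY : Integrable (fun ω => h 0 (X 0 ω) * (h 1 (X 1 ω - ρ 0 1 * X 0 ω) *
      h 2 (X 2 ω - ρ 0 2 * X 0 ω) * h 3 (X 3 ω - ρ 0 3 * X 0 ω))) P :=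
    hB.mono' (by fun_prop) (.of_forall fun ω => by
      simpa only [mul_assoc, Real.norm_eq_abs] using hprod (hbX 0 ω) (hbY 1 (by decide) ω) (hbY 2 (by decide) ω)
        (hbY 3 (by decide) ω))
  rw [← sub_zero (∫ ω, _ ∂P), ← hzero, ← integral_sub hintX hintY, ← Real.norm_eq_abs]
  calc _ ≤ ∫ ω, 3 * r * (√L * S ω ^ 2) ^ 4 ∂P :=
        norm_integral_le_of_norm_le (hB.const_mul _) (.of_forall fun ω =>
          abs_mul_four_sub_le (hbX 0 ω) (hbX 1 ω) (hbX 2 ω) (hbY 2 (by decide) ω)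
            (hbY 3 (by decide) ω) (hdiff 1 (by decide) ω) (hdiff 2 (by decide) ω)
            (hdiff 3 (by decide) ω))
    _ = 3 * r * √L ^ 4 * ∫ ω, S ω ^ 8 ∂P := by
        rw [← integral_const_mul]
        congr with ω
        ring
    _ ≤ 3 * r * √L ^ 4 * (4 ^ 8 * m) := by
        have : 0 ≤ r := (abs_nonneg _).trans (hr 1 (by decide))
        gcongr
    _ = 3 * √L ^ 4 * (4 ^ 8 * m) * r := by ring
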